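/- Let n ≥ 1. For a smooth map f : ℝⁿ → ℝⁿ whose derivative Df(x) is invertible at every x, define ℓ_f(x) := log |det Df(x)| and the multidimensional Schwarzian derivative 𝔖(f)(x), an array with components 𝔖(f)^k_{ij}(x) := ∑_σ ∂_i∂_j f^σ(x)·[(Df(x))^{-1}]^k_σ − (1/(n+1))·( δ^k_i ∂_j ℓ_f(x) + δ^k_j ∂_i ℓ_f(x) ). Then 𝔖 satisfies the cocycle identity: for all smooth f, g : ℝⁿ → ℝⁿ with everywhere invertible derivatives and all x ∈ ℝⁿ and indices i,j,k: 𝔖(f∘g)^k_{ij}(x) = 𝔖(g)^k_{ij}(x) + ∑_{a,b,c} ∂_i g^a(x)·∂_j g^b(x)·𝔖(f)^c_{ab}(g(x))·[(Dg(x))^{-1}]^k_c. -/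

import Mathlib

/-- Partial derivative `∂ᵢ g (x)` of a scalar function on `ℝⁿ`. -/
noncomputable def pd {n : ℕ} (g : (Fin n → ℝ) → ℝ) (i : Fin n) (x : Fin n → ℝ) : ℝ :=
  fderiv ℝ g x (Pi.single i 1)

/-- Jacobian matrix `(Df(x))^σ_i = ∂ᵢ f^σ (x)`. -/
noncomputable def jac {n : ℕ} (f : (Fin n → ℝ) → Fin n → ℝ) (x : Fin n → ℝ) :
    Matrix (Fin n) (Fin n) ℝ :=
  fun σ i => pd (fun y => f y σ) i x

/-- `ℓ_f = log |det Df|`. -/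
noncomputable def logJ {n : ℕ} (f : (Fin n → ℝ) → Fin n → ℝ) (x : Fin n → ℝ) : ℝ :=
  Real.log |(jac f x).det|

/-- Kronecker delta. -/
noncomputable def kdelta {n : ℕ} (i j : Fin n) : ℝ := if i = j then 1 else 0

/-- The multidimensional Schwarzian derivative
`𝔖(f)^k_{ij} = ∂ᵢ∂ⱼf^σ·[(Df)⁻¹]^k_σ − (1/(n+1))(δ^k_i ∂ⱼℓ_f + δ^k_j ∂ᵢℓ_f)`. -/
noncomputable def schw {n : ℕ} (f : (Fin n → ℝ) → Fin n → ℝ) (x : Fin n → ℝ)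
    (k i j : Fin n) : ℝ :=
  (∑ σ, pd (fun y => pd (fun z => f z σ) j y) i x * (jac f x)⁻¹ k σ)
    - (1 / ((n : ℝ) + 1)) *
      (kdelta k i * pd (logJ f) j x + kdelta k j * pd (logJ f) i x)

/-- Chain rule for partial derivatives. -/
theorem pd_comp {n : ℕ} {h : (Fin n → ℝ) → ℝ} {g : (Fin n → ℝ) → Fin n → ℝ} {x : Fin n → ℝ}
    (hh : DifferentiableAt ℝ h (g x)) (hg : DifferentiableAt ℝ g x) (i : Fin n) :
    pd (fun y => h (g y)) i x = ∑ a, pd h a (g x) * pd (fun y => g y a) i x := by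
  have hcomp : fderiv ℝ (fun y => h (g y)) x = (fderiv ℝ h (g x)).comp (fderiv ℝ g x) :=
    fderiv_comp x hh hg
  have hcoord (a : Fin n) :
      fderiv ℝ (fun y => g y a) x (Pi.single i 1) = fderiv ℝ g x (Pi.single i 1) a := by
    rw [fderiv_apply hg]
    rfl
  simp only [pd, hcomp, ContinuousLinearMap.comp_apply, hcoord]
  conv_lhs => rw [pi_eq_sum_univ' (fderiv ℝ g x (Pi.single i 1))]
  simp only [map_sum, map_smul, smul_eq_mul]
  exact Finset.sum_congr rfl fun a _ => mul_comm _ _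

theorem pd_add {n : ℕ} {u v : (Fin n → ℝ) → ℝ} {x : Fin n → ℝ}
    (hu : DifferentiableAt ℝ u x) (hv : DifferentiableAt ℝ v x) (i : Fin n) :
    pd (fun y => u y + v y) i x = pd u i x + pd v i x := by
  simp [pd, fderiv_fun_add hu hv]

theorem pd_sum_mul {n : ℕ} {u v : Fin n → (Fin n → ℝ) → ℝ} {x : Fin n → ℝ}
    (hu : ∀ a, DifferentiableAt ℝ (u a) x) (hv : ∀ a, DifferentiableAt ℝ (v a) x) (i : Fin n) :
    pd (fun y => ∑ a, u a y * v a y) i x =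
      ∑ a, (pd (u a) i x * v a x + u a x * pd (v a) i x) := by
  simp only [pd]
  rw [fderiv_fun_sum fun a _ => (hu a).fun_mul (hv a)]
  simp only [sum_apply]
  refine Finset.sum_congr rfl fun a _ => ?_
  rw [fderiv_fun_mul (hu a) (hv a)]
  simp only [add_apply, smul_apply, smul_eq_mul]
  ring

theorem contDiff_pd {n : ℕ} {h : (Fin n → ℝ) → ℝ} (hh : ContDiff ℝ (⊤ : ℕ∞) h) (i : Fin n) :
    ContDiff ℝ (⊤ : ℕ∞) (pd h i) :=
  (hh.fderiv_right (m := (⊤ : ℕ∞)) (by simp)).clm_apply contDiff_const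

theorem differentiable_jac_apply {n : ℕ} {f : (Fin n → ℝ) → Fin n → ℝ}
    (hf : ContDiff ℝ (⊤ : ℕ∞) f) (σ j : Fin n) : Differentiable ℝ fun y => jac f y σ j :=
  (contDiff_pd (contDiff_pi.1 hf σ) j).differentiable (by simp)

theorem jac_comp {n : ℕ} {f g : (Fin n → ℝ) → Fin n → ℝ} {x : Fin n → ℝ}
    (hf : DifferentiableAt ℝ f (g x)) (hg : DifferentiableAt ℝ g x) :
    jac (f ∘ g) x = jac f (g x) * jac g x := by
  ext σ i
  rw [Matrix.mul_apply]
  exact pd_comp (h := fun z => f z σ) (differentiableAt_pi.1 hf σ) hg i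

theorem differentiable_logJ {n : ℕ} {f : (Fin n → ℝ) → Fin n → ℝ}
    (hf : ContDiff ℝ (⊤ : ℕ∞) f) (hfI : ∀ x, IsUnit (jac f x).det) :
    Differentiable ℝ (logJ f) := by
  have hdet : Differentiable ℝ fun x => (jac f x).det := by
    simp only [Matrix.det_apply']
    have := differentiable_jac_apply hf
    fun_prop
  have hlog : logJ f = fun x => Real.log (jac f x).det := by
    funext x
    simp [logJ, Real.log_abs]
  rw [hlog]
  exact hdet.log fun x => (hfI x).ne_zero

theorem logJ_comp {n : ℕ} {f g : (Fin n → ℝ) → Fin n → ℝ} {x : Fin n → ℝ}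
    (hf : DifferentiableAt ℝ f (g x)) (hg : DifferentiableAt ℝ g x)
    (hfI : IsUnit (jac f (g x)).det) (hgI : IsUnit (jac g x).det) :
    logJ (f ∘ g) x = logJ f (g x) + logJ g x := by
  rw [logJ, jac_comp hf hg, Matrix.det_mul, abs_mul,
    Real.log_mul (abs_ne_zero.2 hfI.ne_zero) (abs_ne_zero.2 hgI.ne_zero)]
  rfl

theorem pd_logJ_comp {n : ℕ} {f g : (Fin n → ℝ) → Fin n → ℝ}
    (hf : ContDiff ℝ (⊤ : ℕ∞) f) (hg : ContDiff ℝ (⊤ : ℕ∞) g)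
    (hfI : ∀ x, IsUnit (jac f x).det) (hgI : ∀ x, IsUnit (jac g x).det)
    (x : Fin n → ℝ) (i : Fin n) :
    pd (logJ (f ∘ g)) i x = ∑ a, pd (logJ f) a (g x) * jac g x a i + pd (logJ g) i x := by
  have hf' : Differentiable ℝ f := hf.differentiable (by simp)
  have hg' : Differentiable ℝ g := hg.differentiable (by simp)
  have hlf := differentiable_logJ hf hfI
  have hlog : logJ (f ∘ g) = fun y => logJ f (g y) + logJ g y :=
    funext fun y => logJ_comp (hf' _) (hg' _) (hfI _) (hgI _)
  rw [hlog, pd_add (u := fun y => logJ f (g y)) (hlf.comp hg' x) (differentiable_logJ hg hgI x), pd_comp (hlf _) (hg' x)]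
  rfl

/-- Second-order chain rule. -/
theorem pd_pd_comp {n : ℕ} {f g : (Fin n → ℝ) → Fin n → ℝ}
    (hf : ContDiff ℝ (⊤ : ℕ∞) f) (hg : ContDiff ℝ (⊤ : ℕ∞) g)
    (x : Fin n → ℝ) (i j σ : Fin n) :
    pd (fun y => pd (fun z => (f ∘ g) z σ) j y) i x =
      ∑ b, ((∑ a, pd (fun y => pd (fun z => f z σ) b y) a (g x) * jac g x a i) * jac g x b j
        + jac f (g x) σ b * pd (fun y => pd (fun z => g z b) j y) i x) := by
  have hf' : Differentiable ℝ f := hf.differentiable (by simp)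
  have hg' : Differentiable ℝ g := hg.differentiable (by simp)
  have hfirst : (fun y => pd (fun z => (f ∘ g) z σ) j y) =
      fun y => ∑ b, jac f (g y) σ b * jac g y b j := by
    funext y
    exact pd_comp (h := fun z => f z σ) (differentiableAt_pi.1 (hf' _) σ) (hg' y) j
  rw [hfirst, pd_sum_mul (u := fun b y => jac f (g y) σ b) (v := fun b y => jac g y b j)
    (fun b => (differentiable_jac_apply hf σ b).comp hg' x)
    (fun b => differentiable_jac_apply hg b j x)]
  refine Finset.sum_congr rfl fun b _ => ?_
  rw [pd_comp (h := fun z => jac f z σ b) (differentiable_jac_apply hf σ b _) (hg' x)]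
  rfl

/-- Contracting `B`, a Kronecker delta and `B⁻¹` gives a Kronecker delta. -/
theorem sum_mul_kdelta_mul_inv {n : ℕ} {B : Matrix (Fin n) (Fin n) ℝ} (hB : IsUnit B.det)
    (i k : Fin n) : ∑ a, ∑ c, B a i * kdelta c a * B⁻¹ k c = kdelta k i := by
  have h := congrFun (congrFun (Matrix.nonsing_inv_mul B hB) k) i
  rw [Matrix.mul_apply, Matrix.one_apply] at h
  rw [kdelta, ← h]
  simp [kdelta, mul_comm]

/-- Cocycle identity for the multidimensional Schwarzian derivative:
`𝔖(f∘g)^k_{ij}(x) = 𝔖(g)^k_{ij}(x) + ∑_{a,b,c} ∂ᵢg^a ∂ⱼg^b 𝔖(f)^c_{ab}(g(x)) [(Dg(x))⁻¹]^k_c`. -/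
theorem schwarzian_cocycle {n : ℕ} (hn : 1 ≤ n)
    (f g : (Fin n → ℝ) → Fin n → ℝ)
    (hf : ContDiff ℝ (⊤ : ℕ∞) f) (hg : ContDiff ℝ (⊤ : ℕ∞) g)
    (hfI : ∀ x, IsUnit (jac f x).det) (hgI : ∀ x, IsUnit (jac g x).det)
    (x : Fin n → ℝ) (i j k : Fin n) :
    schw (f ∘ g) x k i j =
      schw g x k i j +
        ∑ a, ∑ b, ∑ c,
          pd (fun y => g y a) i x * pd (fun y => g y b) j x *
            schw f (g x) c a b * (jac g x)⁻¹ k c := by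
  have hf' : Differentiable ℝ f := hf.differentiable (by simp)
  have hg' : Differentiable ℝ g := hg.differentiable (by simp)
  have hjac (a i : Fin n) : pd (fun y => g y a) i x = jac g x a i := rfl
  simp only [schw, pd_pd_comp hf hg, pd_logJ_comp hf hg hfI hgI, jac_comp (hf' _) (hg' x),
    Matrix.mul_inv_rev, hjac]
  have hB := hgI x
  have hA := hfI (g x)
  generalize jac g x = B at *
  generalize jac f (g x) = A at *
  generalize hF : (fun σ a b => pd (fun y => pd (fun z => f z σ) b y) a (g x)) = F
  generalize hG : (fun b => pd (fun y => pd (fun z => g z b) j y) i x) = G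
  generalize hL : (fun a => pd (logJ f) a (g x)) = L
  have hF' (σ a b) : pd (fun y => pd (fun z => f z σ) b y) a (g x) = F σ a b := by rw [← hF]
  have hG' (b) : pd (fun y => pd (fun z => g z b) j y) i x = G b := by rw [← hG]
  have hL' (a) : pd (logJ f) a (g x) = L a := by rw [← hL]
  simp only [hF', hG', hL']
  have hsecond : ∑ σ, (∑ b, ((∑ a, F σ a b * B a i) * B b j + A σ b * G b)) * (B⁻¹ * A⁻¹) k σ =
      ∑ b, G b * B⁻¹ k b +
        ∑ a, ∑ b, ∑ c, B a i * B b j * (∑ σ, F σ a b * A⁻¹ c σ) * B⁻¹ k c := by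
    have hcancel (b : Fin n) : ∑ σ, (B⁻¹ * A⁻¹) k σ * A σ b = B⁻¹ k b := by
      rw [← Matrix.mul_apply, Matrix.mul_assoc, Matrix.nonsing_inv_mul A hA, Matrix.mul_one]
    simp only [Finset.sum_add_distrib, add_mul]
    rw [add_comm]
    congr 1
    · simp only [← hcancel, Finset.sum_mul, Finset.mul_sum]
      rw [Finset.sum_comm]
      exact Finset.sum_congr rfl fun b _ => Finset.sum_congr rfl fun σ _ => by ring
    · have hc (a b : Fin n) : ∑ c, B a i * B b j * (∑ σ, F σ a b * A⁻¹ c σ) * B⁻¹ k c =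
          ∑ σ, F σ a b * B a i * B b j * (B⁻¹ * A⁻¹) k σ := by
        simp only [Matrix.mul_apply, Finset.sum_mul, Finset.mul_sum]
        rw [Finset.sum_comm]
        exact Finset.sum_congr rfl fun σ _ => Finset.sum_congr rfl fun c _ => by ring
      simp only [hc, Finset.sum_mul]
      exact (Finset.sum_comm.trans (Finset.sum_congr rfl fun b _ => Finset.sum_comm)).trans
        Finset.sum_comm
  have hleft : ∑ a, ∑ b, ∑ c, B a i * B b j * (kdelta c a * L b) * B⁻¹ k c =
      kdelta k i * ∑ b, L b * B b j := by
    rw [← sum_mul_kdelta_mul_inv hB i k, Finset.sum_mul]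
    refine Finset.sum_congr rfl fun a _ => ?_
    rw [Finset.sum_mul_sum, Finset.sum_comm]
    exact Finset.sum_congr rfl fun c _ => Finset.sum_congr rfl fun b _ => by ring
  have hright : ∑ a, ∑ b, ∑ c, B a i * B b j * (kdelta c b * L a) * B⁻¹ k c =
      kdelta k j * ∑ a, L a * B a i := by
    rw [← sum_mul_kdelta_mul_inv hB j k, mul_comm, Finset.sum_mul_sum]
    refine Finset.sum_congr rfl fun a _ => Finset.sum_congr rfl fun b _ => ?_
    rw [Finset.mul_sum]
    exact Finset.sum_congr rfl fun c _ => by ring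
  have hsplit : ∑ a, ∑ b, ∑ c, B a i * B b j * ((∑ σ, F σ a b * A⁻¹ c σ)
        - 1 / ((n : ℝ) + 1) * (kdelta c a * L b + kdelta c b * L a)) * B⁻¹ k c =
      ∑ a, ∑ b, ∑ c, B a i * B b j * (∑ σ, F σ a b * A⁻¹ c σ) * B⁻¹ k c
        - 1 / ((n : ℝ) + 1) *
          (∑ a, ∑ b, ∑ c, B a i * B b j * (kdelta c a * L b) * B⁻¹ k c
            + ∑ a, ∑ b, ∑ c, B a i * B b j * (kdelta c b * L a) * B⁻¹ k c) := by
    simp only [← Finset.sum_add_distrib]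
    simp only [Finset.mul_sum _ _ (1 / ((n : ℝ) + 1)), ← Finset.sum_sub_distrib]
    exact Finset.sum_congr rfl fun a _ => Finset.sum_congr rfl fun b _ =>
      Finset.sum_congr rfl fun c _ => by ring
  rw [hsecond, hsplit, hleft, hright]
  ring
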